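/- arXiv:2307.09645 — 2 statements merged into one kernel-verified Lean document; each statement's English description precedes it below -/
import Mathlib

section
/- Let M be a positive monoid consisting of algebraic numbers, and let E(M) be the additive submonoid of ℝ generated by {e^m : m ∈ M} (which is a subsemiring of ℝ). If M is a bounded factorization monoid (BFM), then E(M) is a bounded factorization semiring; that is, the multiplicative monoid of nonzero elements of E(M) is atomic and for every nonzero q ∈ E(M) the set of lengths of multiplicative factorizations of q into multiplicative atoms of E(M) is finite. -/
/-- `a` is an (additive) atom of the set `M ⊆ ℝ`. -/
def IsAddAtom (M : Set ℝ) (a : ℝ) : Prop :=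
  a ∈ M ∧ a ≠ 0 ∧ ∀ b ∈ M, ∀ c ∈ M, a = b + c → b = 0 ∨ c = 0

/-- The additive factorizations of `x` in `M`. -/
def AddFactorizations (M : Set ℝ) (x : ℝ) : Set (Multiset ℝ) :=
  {s | (∀ a ∈ s, IsAddAtom M a) ∧ s.sum = x}

/-- `M` is (additively) atomic. -/
def IsAddAtomic (M : Set ℝ) : Prop :=
  ∀ x ∈ M, x ≠ 0 → (AddFactorizations M x).Nonempty

/-- `M` is a bounded factorization monoid. -/
def IsBFM (M : Set ℝ) : Prop :=
  IsAddAtomic M ∧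
    ∀ x ∈ M, {ℓ : ℕ | ∃ s ∈ AddFactorizations M x, Multiset.card s = ℓ}.Finite

/-- `a` is a multiplicative atom of the set `S ⊆ ℝ` (whose only unit is `1`). -/
def IsMulAtom (S : Set ℝ) (a : ℝ) : Prop :=
  a ∈ S ∧ a ≠ 0 ∧ a ≠ 1 ∧ ∀ b ∈ S, ∀ c ∈ S, a = b * c → b = 1 ∨ c = 1

/-- The multiplicative factorizations of `q` in `S`: multisets of multiplicative
atoms of `S` whose product is `q`. -/
def MulFactorizations (S : Set ℝ) (q : ℝ) : Set (Multiset ℝ) :=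
  {s | (∀ a ∈ s, IsMulAtom S a) ∧ s.prod = q}

open Polynomial in
theorem Polynomial.ringHom_aeval_int {A B : Type*} [CommRing A] [CommRing B] (φ : A →+* B) (x : A)
    (g : ℤ[X]) : φ (aeval x g) = aeval (φ x) g :=
  (aeval_algHom_apply φ.toIntAlgHom x g).symm

open Polynomial in
theorem Polynomial.isIntegral_pow_smul_aeval {A : Type*} [CommRing A] {a : ℤ} {x : A}
    (hx : IsIntegral ℤ (a • x)) {g : ℤ[X]} {N : ℕ} (hg : g.natDegree ≤ N) :
    IsIntegral ℤ (a ^ N • aeval x g) := by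
  rw [aeval_eq_sum_range' (Nat.lt_succ_of_le hg), Finset.smul_sum]
  refine IsIntegral.sum _ fun i hi => ?_
  have hi' : i ≤ N := Nat.lt_succ_iff.mp (Finset.mem_range.mp hi)
  have : a ^ N • g.coeff i • x ^ i = (a ^ (N - i) * g.coeff i) • (a • x) ^ i := by
    simp only [zsmul_eq_mul]
    push_cast
    rw [mul_pow, ← Nat.sub_add_cancel hi', pow_add, Nat.sub_add_cancel hi']
    ring
  rw [this]
  exact (hx.pow i).smul _

open Polynomial in
theorem Polynomial.exists_eval_zero_ne_zero_and_aeval_eq_zero {K : Type*} [Field K] [Algebra ℚ K]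
    [Algebra.IsAlgebraic ℚ K] (B : Finset K) (h0 : (0 : K) ∉ B) :
    ∃ f : ℤ[X], f.eval 0 ≠ 0 ∧ ∀ β ∈ B, aeval β f = 0 := by
  have key (β : K) : ∃ f : ℤ[X], β ≠ 0 → f.eval 0 ≠ 0 ∧ aeval β f = 0 := by
    by_cases hβ : β = 0
    · exact ⟨0, fun h => absurd hβ h⟩
    have halg : IsAlgebraic ℤ β :=
      (IsFractionRing.isAlgebraic_iff ℤ ℚ K).mpr (Algebra.IsAlgebraic.isAlgebraic β)
    obtain ⟨q, hq, hq'⟩ := halg.exists_nonzero_coeff_and_aeval_eq_zero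
      (mem_nonZeroDivisors_of_ne_zero hβ)
    exact ⟨q, fun _ => ⟨by rwa [← coeff_zero_eq_eval_zero], hq'⟩⟩
  choose f hf using key
  refine ⟨∏ β ∈ B, f β, ?_, fun β hβ => ?_⟩
  · rw [eval_prod]
    exact Finset.prod_ne_zero_iff.mpr fun β hβ => (hf β (ne_of_mem_of_not_mem hβ h0)).1
  · rw [map_prod]
    exact Finset.prod_eq_zero hβ (hf β (ne_of_mem_of_not_mem hβ h0)).2

theorem exists_int_eq_of_isIntegral_of_fixed {K : Type*} [Field K] [Algebra ℚ K]
    [FiniteDimensional ℚ K] [IsGalois ℚ K] {x : K} (hx : IsIntegral ℤ x)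
    (hfix : ∀ σ : K ≃ₐ[ℚ] K, σ x = x) : ∃ n : ℤ, (n : K) = x := by
  obtain ⟨r, rfl⟩ := (IsGalois.mem_range_algebraMap_iff_fixed x).mpr hfix
  rw [isIntegral_algebraMap_iff (algebraMap ℚ K).injective] at hx
  obtain ⟨n, rfl⟩ := IsIntegrallyClosed.isIntegral_iff.mp hx
  exact ⟨n, by simp⟩

open Filter Topology Nat in
theorem eventually_mul_pow_mul_pow_div_factorial_lt_one (C a c : ℝ) (d : ℕ) :
    ∀ᶠ p : ℕ in atTop, a ^ (p * d) * (C * (c ^ p / (p - 1)!)) < 1 := by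
  have h := (FloorSemiring.tendsto_pow_div_factorial_atTop (a ^ d * c)).const_mul (C * (a ^ d * c))
  rw [mul_zero] at h
  have h' := (tendsto_sub_atTop_nat 1).eventually (h.eventually (gt_mem_nhds zero_lt_one))
  filter_upwards [h', eventually_ge_atTop 1] with p hp hp1
  obtain ⟨m, rfl⟩ := Nat.exists_eq_add_of_le' hp1
  simp only [Nat.add_sub_cancel] at hp ⊢
  refine lt_of_eq_of_lt ?_ hp
  rw [mul_comm (m + 1) d, pow_mul]
  ring

open Polynomial Complex in
theorem LindemannWeierstrass.int_add_sum_ne_zero_of_invariant {K : Type*} [Field K] [Algebra ℚ K]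
    [FiniteDimensional ℚ K] [IsGalois ℚ K] (ι : K →+* ℂ) (B : Finset K) (h0 : (0 : K) ∉ B)
    (b : K → ℤ) (hb : ∀ (σ : K ≃ₐ[ℚ] K) x, b (σ x) = b x)
    (hB : ∀ (σ : K ≃ₐ[ℚ] K), ∀ x ∈ B, σ x ∈ B) (k : ℤ) (hk : k ≠ 0) :
    (k : ℂ) + ∑ β ∈ B, b β * exp (ι β) ≠ 0 := by
  intro hsum
  obtain ⟨f, hf0, hf⟩ := exists_eval_zero_ne_zero_and_aeval_eq_zero B h0
  have hfne : f ≠ 0 := by rintro rfl; simp at hf0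
  set a := f.leadingCoeff with ha
  have ha0 : a ≠ 0 := leadingCoeff_ne_zero.mpr hfne
  obtain ⟨c, hc⟩ := exp_polynomial_approx f hf0
  set C : ℝ := ∑ β ∈ B, |(b β : ℝ)| with hC
  obtain ⟨N, hN⟩ := Filter.eventually_atTop.mp
    (eventually_mul_pow_mul_pow_div_factorial_lt_one C |(a : ℝ)| c f.natDegree)
  obtain ⟨p, hpN, hp⟩ := Nat.exists_infinite_primes
    (N + (eval 0 f).natAbs + a.natAbs + k.natAbs + 1)
  obtain ⟨n, hpn, g, hg, hgr⟩ := hc p (by omega) hp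
  replace hN := hN p (by omega)
  set E := p * f.natDegree
  have hint (β : K) (hβ : β ∈ B) : IsIntegral ℤ (a ^ E • aeval β g) :=
    isIntegral_pow_smul_aeval (isIntegral_leadingCoeff_smul f β (hf β hβ)) (by omega)
  obtain ⟨s, hs⟩ : ∃ s : ℤ, (s : K) = ∑ β ∈ B, b β • (a ^ E • aeval β g) := by
    apply exists_int_eq_of_isIntegral_of_fixed
    · exact IsIntegral.sum _ fun β hβ => (hint β hβ).smul _
    · intro σ
      rw [map_sum]
      refine Finset.sum_bij (fun β _ => σ β) (fun β hβ => hB σ β hβ)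
        (fun _ _ _ _ h => σ.injective h) (fun β hβ => ⟨σ.symm β, hB σ.symm β hβ, by simp⟩)
        fun β _ => ?_
      rw [map_zsmul, map_zsmul, hb]
      congr 2
      exact ringHom_aeval_int (σ : K →+* K) β g
  have hs' : (s : ℂ) = ∑ β ∈ B, b β * (a ^ E * aeval (ι β) g) := by
    have := congrArg ι hs
    simp only [map_intCast, map_sum, zsmul_eq_mul, map_mul, Int.cast_pow, map_pow] at this
    rw [this]
    refine Finset.sum_congr rfl fun β _ => ?_
    congr 2
    exact ringHom_aeval_int ι β g
  have hlt : ‖((a ^ E * (n * k) + p * s : ℤ) : ℂ)‖ < 1 := by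
    have : ((a ^ E * (n * k) + p * s : ℤ) : ℂ) =
        - (a ^ E * ∑ β ∈ B, b β * (n • exp (ι β) - p • aeval (ι β) g)) := by
      push_cast
      rw [hs', eq_neg_of_add_eq_zero_left hsum]
      simp only [mul_sub, Finset.sum_sub_distrib, Finset.mul_sum, zsmul_eq_mul, nsmul_eq_mul,
        mul_neg, neg_sub]
      rw [sub_eq_neg_add]
      congr 1
      · rw [neg_inj]
        exact Finset.sum_congr rfl fun _ _ => by ring
      · exact Finset.sum_congr rfl fun _ _ => by ring
    rw [this, norm_neg, norm_mul, norm_pow, Complex.norm_intCast]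
    refine lt_of_le_of_lt ?_ hN
    gcongr
    rw [hC, Finset.sum_mul]
    refine norm_sum_le_of_le _ fun β hβ => ?_
    rw [norm_mul, Complex.norm_intCast]
    gcongr
    apply hgr
    rw [mem_aroots]
    refine ⟨hfne, ?_⟩
    rw [← ringHom_aeval_int, hf β hβ, map_zero]
  rw [Complex.norm_intCast] at hlt
  have hzero : a ^ E * (n * k) + p * s = 0 := Int.abs_lt_one_iff.mp (by exact_mod_cast hlt)
  have hdvd : (p : ℤ) ∣ a ^ E * (n * k) := ⟨-s, by linarith⟩
  have hpp := Nat.prime_iff_prime_int.mp hp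
  have hsmall (z : ℤ) (hz : z ≠ 0) (hzp : z.natAbs < p) : ¬ (p : ℤ) ∣ z := fun h =>
    absurd (Nat.le_of_dvd (Int.natAbs_pos.mpr hz) (Int.natCast_dvd.mp h)) (by omega)
  rcases hpp.dvd_or_dvd hdvd with h | h
  · exact hsmall a ha0 (by omega) (hpp.dvd_of_dvd_pow h)
  · exact (hpp.dvd_or_dvd h).elim hpn (hsmall k hk (by omega))

/-- The evaluation `∑ cᵢ · [aᵢ] ↦ ∑ cᵢ exp (ι aᵢ)` of the group ring of the additive group of `K`. -/
noncomputable def expEval {K : Type*} [Field K] (ι : K →+* ℂ) : AddMonoidAlgebra ℤ K →ₐ[ℤ] ℂ :=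
  AddMonoidAlgebra.lift ℤ ℂ K
    { toFun := fun x => Complex.exp (ι x.toAdd)
      map_one' := by simp
      map_mul' := fun x y => by simp [Complex.exp_add] }

theorem expEval_apply {K : Type*} [Field K] (ι : K →+* ℂ) (x : AddMonoidAlgebra ℤ K) :
    expEval ι x = ∑ β ∈ x.coeff.support, x.coeff β * Complex.exp (ι β) := by
  simp [expEval, AddMonoidAlgebra.lift_apply, Finsupp.sum]

/-- The action of an automorphism of `K` on the group ring of the additive group of `K`. -/
noncomputable abbrev conjAlgEquiv {K : Type*} [Field K] [Algebra ℚ K] (σ : K ≃ₐ[ℚ] K) :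
    AddMonoidAlgebra ℤ K ≃ₐ[ℤ] AddMonoidAlgebra ℤ K :=
  AddMonoidAlgebra.domCongr ℤ ℤ σ.toAddEquiv

theorem expEval_ne_zero_of_invariant {K : Type*} [Field K] [Algebra ℚ K]
    [FiniteDimensional ℚ K] [IsGalois ℚ K] (ι : K →+* ℂ) (x : AddMonoidAlgebra ℤ K)
    (hx : ∀ σ : K ≃ₐ[ℚ] K, conjAlgEquiv σ x = x) (h0 : x.coeff 0 ≠ 0) : expEval ι x ≠ 0 := by
  classical
  have hinv (σ : K ≃ₐ[ℚ] K) (β : K) : x.coeff (σ β) = x.coeff β := by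
    conv_lhs => rw [← hx σ]
    rw [AddMonoidAlgebra.coeff_domCongr]
    exact congrArg _ (σ.symm_apply_apply β)
  rw [expEval_apply, ← Finset.add_sum_erase _ _ (Finsupp.mem_support_iff.mpr h0), map_zero ι,
    Complex.exp_zero, mul_one]
  refine LindemannWeierstrass.int_add_sum_ne_zero_of_invariant ι _ (by simp) x.coeff hinv
    (fun σ β hβ => ?_) _ h0
  simpa [hinv] using hβ

theorem expEval_injective {K : Type*} [Field K] [Algebra ℚ K]
    [FiniteDimensional ℚ K] [IsGalois ℚ K] (ι : K →+* ℂ) :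
    Function.Injective (expEval ι) := by
  classical
  rw [injective_iff_map_eq_zero]
  intro x hx
  by_contra hne
  set y := ∏ σ : K ≃ₐ[ℚ] K, conjAlgEquiv σ x with hy
  have hcomp (σ τ : K ≃ₐ[ℚ] K) (z : AddMonoidAlgebra ℤ K) :
      conjAlgEquiv τ (conjAlgEquiv σ z) = conjAlgEquiv (τ * σ) z := by
    ext β
    simp only [AddMonoidAlgebra.coeff_domCongr]
    rfl
  have hyinv (τ : K ≃ₐ[ℚ] K) : conjAlgEquiv τ y = y := by
    rw [hy, map_prod]
    simp only [hcomp]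
    exact Fintype.prod_equiv (Equiv.mulLeft τ) _ _ fun _ => rfl
  have hy0 : y ≠ 0 := Finset.prod_ne_zero_iff.mpr fun σ _ => by simpa using hne
  have hyev : expEval ι y = 0 := by
    rw [hy, map_prod]
    refine Finset.prod_eq_zero (Finset.mem_univ 1) ?_
    rw [← hx]
    congr 1
    ext β
    simp only [AddMonoidAlgebra.coeff_domCongr]
    rfl
  obtain ⟨β, hβ⟩ : ∃ β, y.coeff β ≠ 0 := by
    by_contra! h
    exact hy0 (by ext β; simpa using h β)
  set z : AddMonoidAlgebra ℤ K :=
    ∑ σ : K ≃ₐ[ℚ] K, AddMonoidAlgebra.single (-(σ β)) 1 with hz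
  have hzinv (τ : K ≃ₐ[ℚ] K) : conjAlgEquiv τ z = z := by
    rw [hz, map_sum]
    simp only [AddMonoidAlgebra.domCongr_single]
    refine Fintype.sum_equiv (Equiv.mulLeft τ) _ _ fun σ => ?_
    simp
  refine expEval_ne_zero_of_invariant ι (z * y) (fun σ => by rw [map_mul, hyinv, hzinv]) ?_
    (by rw [map_mul, hyev, mul_zero])
  have hcoe (σ : K ≃ₐ[ℚ] K) : y.coeff (σ β) = y.coeff β := by
    conv_lhs => rw [← hyinv σ]
    rw [AddMonoidAlgebra.coeff_domCongr]
    exact congrArg _ (σ.symm_apply_apply β)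
  rw [hz, Finset.sum_mul]
  simp only [AddMonoidAlgebra.coeff_sum, Finsupp.finsetSum_apply,
    AddMonoidAlgebra.coeff_single_mul_apply, one_mul, neg_neg, add_zero, hcoe]
  simpa using hβ

theorem AddMonoidAlgebra.coeff_multiset_sum_single {G : Type*} [DecidableEq G] (v : Multiset G)
    (g : G) : (v.map fun b => AddMonoidAlgebra.single b (1 : ℤ)).sum.coeff g = v.count g := by
  induction v using Multiset.induction_on with
  | empty => simp
  | cons b v ih =>
    rw [Multiset.map_cons, Multiset.sum_cons, AddMonoidAlgebra.coeff_add, Finsupp.add_apply, ih,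
      Multiset.count_cons, AddMonoidAlgebra.coeff_single, Finsupp.single_apply]
    simp only [eq_comm (a := g)]
    push_cast
    ring

/-- The Lindemann–Weierstrass theorem for real exponents and natural number coefficients:
multisets of real algebraic numbers are determined by their sums of exponentials. -/
theorem multiset_eq_of_sum_exp_eq {s t : Multiset ℝ} (hs : ∀ x ∈ s, IsAlgebraic ℚ x)
    (ht : ∀ x ∈ t, IsAlgebraic ℚ x) (h : (s.map Real.exp).sum = (t.map Real.exp).sum) : s = t := by
  classical
  set S : Set ℂ := (fun x : ℝ => (x : ℂ)) '' {x | x ∈ s + t} with hS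
  have hfin : S.Finite := by
    refine Set.Finite.image _ ?_
    exact (s + t).toFinset.finite_toSet.subset fun x hx => by simpa using hx
  have halg : ∀ x ∈ S, IsIntegral ℚ x := by
    rintro _ ⟨x, hx, rfl⟩
    have : IsAlgebraic ℚ x := (Multiset.mem_add.mp hx).elim (hs x) (ht x)
    exact (this.isIntegral).map (Complex.ofRealHom.toRatAlgHom)
  have : Finite S := hfin
  have := IntermediateField.finiteDimensional_adjoin halg
  let K := IntermediateField.normalClosure ℚ (IntermediateField.adjoin ℚ S) ℂ
  have hSK {x : ℝ} (hx : x ∈ s + t) : (x : ℂ) ∈ K :=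
    IntermediateField.le_normalClosure _ (IntermediateField.subset_adjoin ℚ S ⟨x, hx, rfl⟩)
  have : Algebra.IsAlgebraic ℚ (IntermediateField.adjoin ℚ S) := Algebra.IsAlgebraic.of_finite _ _
  have : Normal ℚ K := (Algebra.IsAlgebraic.isNormalClosure_normalClosure
    (F := ℚ) (K := IntermediateField.adjoin ℚ S) (L := ℂ)
    fun _ => IsAlgClosed.splits _).normal
  have : IsGalois ℚ K := ⟨⟩
  let φ : ℝ → K := fun x => if hx : (x : ℂ) ∈ K then ⟨x, hx⟩ else 0
  have hφ {x : ℝ} (hx : x ∈ s + t) : (φ x : ℂ) = x := by simp [φ, hSK hx]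
  have heval (u : Multiset ℝ) (hu : u ≤ s + t) :
      expEval (algebraMap K ℂ) ((u.map φ).map fun b => AddMonoidAlgebra.single b 1).sum =
        ((u.map Real.exp).sum : ℝ) := by
    rw [map_multiset_sum, Multiset.map_map, Multiset.map_map, ← Complex.ofRealHom_eq_coe,
      map_multiset_sum, Multiset.map_map]
    congr 1
    refine Multiset.map_congr rfl fun x hx => ?_
    simp [expEval, hφ (Multiset.mem_of_le hu hx)]
  have hre (u : Multiset ℝ) (hu : u ≤ s + t) : (u.map φ).map (fun z : K => (z : ℂ).re) = u := by
    rw [Multiset.map_map]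
    conv_rhs => rw [← Multiset.map_id u]
    refine Multiset.map_congr rfl fun x hx => ?_
    simp [hφ (Multiset.mem_of_le hu hx)]
  have hst : s.map φ = t.map φ := by
    have := expEval_injective (algebraMap K ℂ)
      ((heval s (Multiset.le_add_right s t)).trans
        ((congrArg _ h).trans (heval t (Multiset.le_add_left t s)).symm))
    ext b
    have hb := congrArg (fun y => y.coeff b) this
    simp only [AddMonoidAlgebra.coeff_multiset_sum_single] at hb
    exact_mod_cast hb
  rw [← hre s (Multiset.le_add_right s t), hst, hre t (Multiset.le_add_left t s)]

/-- In a bounded factorization monoid, the number of nonzero summands in a decomposition of `x`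
is bounded. -/
theorem IsBFM.exists_card_le {M : AddSubmonoid ℝ} (hM : IsBFM (M : Set ℝ)) {x : ℝ} (hx : x ∈ M) :
    ∃ B : ℕ, ∀ (v : Multiset ℝ), (∀ y ∈ v, y ∈ M ∧ y ≠ 0) → ∀ n ∈ M, v.sum + n = x →
      Multiset.card v ≤ B := by
  obtain ⟨B, hB⟩ := (hM.2 x hx).bddAbove
  refine ⟨B, fun v hv n hn hvn => ?_⟩
  have hex (y : ℝ) : ∃ s : Multiset ℝ, y ∈ M →
      (∀ a ∈ s, IsAddAtom (M : Set ℝ) a) ∧ s.sum = y ∧ (y ≠ 0 → 1 ≤ Multiset.card s) := by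
    by_cases hy : y ∈ M
    · by_cases hy0 : y = 0
      · exact ⟨0, fun _ => by simp [hy0]⟩
      · obtain ⟨s, hs, hs'⟩ := hM.1 y hy hy0
        refine ⟨s, fun _ => ⟨hs, hs', fun _ => Nat.one_le_iff_ne_zero.mpr fun h => hy0 ?_⟩⟩
        rw [Multiset.card_eq_zero.mp h] at hs'
        simpa using hs'.symm
    · exact ⟨0, fun h => absurd h hy⟩
  choose F hF using hex
  have hmem : F n + v.bind F ∈ AddFactorizations (M : Set ℝ) x := by
    refine ⟨fun a ha => ?_, ?_⟩
    · rcases Multiset.mem_add.mp ha with ha | ha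
      · exact (hF n hn).1 a ha
      · obtain ⟨y, hy, hay⟩ := Multiset.mem_bind.mp ha
        exact (hF y (hv y hy).1).1 a hay
    · rw [Multiset.sum_add, Multiset.sum_bind, (hF n hn).2.1,
        Multiset.map_congr rfl fun y hy => (hF y (hv y hy).1).2.1, Multiset.map_id', add_comm, hvn]
  refine le_trans ?_ (hB ⟨_, hmem, rfl⟩)
  rw [Multiset.card_add, Multiset.card_bind]
  refine le_trans ?_ (Nat.le_add_left _ _)
  have := Multiset.card_nsmul_le_sum (s := v.map (Multiset.card ∘ F)) (a := 1) fun k hk => by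
    obtain ⟨y, hy, rfl⟩ := Multiset.mem_map.mp hk
    exact (hF y (hv y hy).1).2.2 (hv y hy).2
  simpa using this

theorem mem_closure_exp_iff {M : AddSubmonoid ℝ} {q : ℝ} :
    q ∈ AddSubmonoid.closure (Real.exp '' (M : Set ℝ)) ↔
      ∃ s : Multiset ℝ, (∀ x ∈ s, x ∈ M) ∧ (s.map Real.exp).sum = q := by
  constructor
  · intro hq
    induction hq using AddSubmonoid.closure_induction with
    | mem q hq =>
      obtain ⟨m, hm, rfl⟩ := hq
      exact ⟨{m}, by simpa using hm, by simp⟩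
    | zero => exact ⟨0, by simp, by simp⟩
    | add a b _ _ ha hb =>
      obtain ⟨s, hs, rfl⟩ := ha
      obtain ⟨t, ht, rfl⟩ := hb
      exact ⟨s + t, fun x hx => (Multiset.mem_add.mp hx).elim (hs x) (ht x), by simp⟩
  · rintro ⟨s, hs, rfl⟩
    refine AddSubmonoid.multiset_sum_mem _ _ fun y hy => ?_
    obtain ⟨x, hx, rfl⟩ := Multiset.mem_map.mp hy
    exact AddSubmonoid.subset_closure ⟨x, hs x hx, rfl⟩

theorem one_mem_closure_exp (M : AddSubmonoid ℝ) :
    (1 : ℝ) ∈ AddSubmonoid.closure (Real.exp '' (M : Set ℝ)) :=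
  AddSubmonoid.subset_closure ⟨0, M.zero_mem, Real.exp_zero⟩

theorem mul_mem_closure_exp {M : AddSubmonoid ℝ} {a b : ℝ}
    (ha : a ∈ AddSubmonoid.closure (Real.exp '' (M : Set ℝ)))
    (hb : b ∈ AddSubmonoid.closure (Real.exp '' (M : Set ℝ))) :
    a * b ∈ AddSubmonoid.closure (Real.exp '' (M : Set ℝ)) := by
  induction ha, hb using AddSubmonoid.closure_induction₂ with
  | mem x y hx hy =>
    obtain ⟨m, hm, rfl⟩ := hx
    obtain ⟨n, hn, rfl⟩ := hy
    exact AddSubmonoid.subset_closure ⟨m + n, M.add_mem hm hn, Real.exp_add m n⟩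
  | zero_left => simp
  | zero_right => simp
  | add_left x y z _ _ _ h₁ h₂ => rw [add_mul]; exact add_mem h₁ h₂
  | add_right x y z _ _ _ h₁ h₂ => rw [mul_add]; exact add_mem h₁ h₂

theorem multiset_prod_mem_closure_exp {M : AddSubmonoid ℝ} (u : Multiset ℝ)
    (hu : ∀ a ∈ u, a ∈ AddSubmonoid.closure (Real.exp '' (M : Set ℝ))) :
    u.prod ∈ AddSubmonoid.closure (Real.exp '' (M : Set ℝ)) :=
  Multiset.prod_induction _ u (fun _ _ => mul_mem_closure_exp) (one_mem_closure_exp M) hu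

/-- An element of the exponentiation semiring is zero, an exponential, or at least two. -/
theorem eq_zero_or_exp_or_two_le_of_mem_closure_exp {M : AddSubmonoid ℝ}
    (hpos : ∀ x ∈ M, (0 : ℝ) ≤ x) {q : ℝ}
    (hq : q ∈ AddSubmonoid.closure (Real.exp '' (M : Set ℝ))) :
    q = 0 ∨ (∃ m ∈ M, q = Real.exp m) ∨ 2 ≤ q := by
  obtain ⟨s, hs, rfl⟩ := mem_closure_exp_iff.mp hq
  have hcard : (Multiset.card s : ℝ) ≤ (s.map Real.exp).sum := by
    have := Multiset.card_nsmul_le_sum (s := s.map Real.exp) (a := (1 : ℝ)) fun k hk => by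
      obtain ⟨y, hy, rfl⟩ := Multiset.mem_map.mp hk
      exact Real.one_le_exp (hpos y (hs y hy))
    simpa using this
  rcases Nat.lt_trichotomy (Multiset.card s) 1 with h | h | h
  · left
    simp [Multiset.card_eq_zero.mp (Nat.lt_one_iff.mp h)]
  · obtain ⟨m, rfl⟩ := Multiset.card_eq_one.mp h
    exact .inr (.inl ⟨m, hs m (by simp), by simp⟩)
  · exact .inr (.inr (le_trans (by exact_mod_cast h) hcard))

theorem exists_card_le_of_exp_mul_eq {M : AddSubmonoid ℝ} (halg : ∀ x ∈ M, IsAlgebraic ℚ x)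
    (hM : IsBFM (M : Set ℝ)) {q : ℝ}
    (hq : q ∈ AddSubmonoid.closure (Real.exp '' (M : Set ℝ))) (hq0 : q ≠ 0) :
    ∃ B : ℕ, ∀ (v : Multiset ℝ), (∀ y ∈ v, y ∈ M ∧ y ≠ 0) →
      ∀ r ∈ AddSubmonoid.closure (Real.exp '' (M : Set ℝ)), Real.exp v.sum * r = q →
        Multiset.card v ≤ B := by
  classical
  obtain ⟨t, ht, rfl⟩ := mem_closure_exp_iff.mp hq
  have hex (x : ℝ) : ∃ B : ℕ, x ∈ M → ∀ (v : Multiset ℝ), (∀ y ∈ v, y ∈ M ∧ y ≠ 0) →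
      ∀ n ∈ M, v.sum + n = x → Multiset.card v ≤ B := by
    by_cases hx : x ∈ M
    · exact (hM.exists_card_le hx).imp fun _ h _ => h
    · exact ⟨0, fun h => absurd h hx⟩
  choose B hB using hex
  refine ⟨t.toFinset.sup B, fun v hv r hr hvr => ?_⟩
  obtain ⟨n, hn, rfl⟩ := mem_closure_exp_iff.mp hr
  have hvM : v.sum ∈ M := AddSubmonoid.multiset_sum_mem _ _ fun y hy => (hv y hy).1
  have heq : n.map (v.sum + ·) = t := by
    refine multiset_eq_of_sum_exp_eq (fun x hx => ?_) (fun x hx => halg x (ht x hx)) ?_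
    · obtain ⟨y, hy, rfl⟩ := Multiset.mem_map.mp hx
      exact halg _ (M.add_mem hvM (hn y hy))
    · rw [← hvr, ← Multiset.sum_map_mul_left, Multiset.map_map]
      simp only [Function.comp_def, Real.exp_add]
  obtain ⟨y, hy⟩ : ∃ y, y ∈ n := Multiset.exists_mem_of_ne_zero fun h => hq0 (by
    rw [← hvr, h]; simp)
  have hyt : v.sum + y ∈ t := heq ▸ Multiset.mem_map_of_mem _ hy
  exact (hB _ (ht _ hyt) v hv y (hn y hy) rfl).trans
    (Finset.le_sup (f := B) (Multiset.mem_toFinset.mpr hyt))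

theorem exists_card_le_of_prod_eq {M : AddSubmonoid ℝ} (hpos : ∀ x ∈ M, (0 : ℝ) ≤ x)
    (halg : ∀ x ∈ M, IsAlgebraic ℚ x) (hM : IsBFM (M : Set ℝ)) {q : ℝ}
    (hq : q ∈ AddSubmonoid.closure (Real.exp '' (M : Set ℝ))) (hq0 : q ≠ 0) :
    ∃ B : ℕ, ∀ u : Multiset ℝ,
      (∀ a ∈ u, a ∈ AddSubmonoid.closure (Real.exp '' (M : Set ℝ)) ∧ a ≠ 1) →
        u.prod = q → Multiset.card u ≤ B := by
  classical
  obtain ⟨B, hB⟩ := exists_card_le_of_exp_mul_eq halg hM hq hq0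
  obtain ⟨L, hL⟩ := pow_unbounded_of_one_lt q one_lt_two
  refine ⟨B + L, fun u hu huq => ?_⟩
  have hu0 (a : ℝ) (ha : a ∈ u) : a ≠ 0 := by
    rintro rfl
    exact hq0 (huq ▸ Multiset.prod_eq_zero ha)
  set P : ℝ → Prop := fun a => ∃ m ∈ M, a = Real.exp m
  have hsplit : u.filter P + u.filter (fun a => ¬ P a) = u := Multiset.filter_add_not P u
  have hlog (a : ℝ) (ha : a ∈ u.filter P) : Real.log a ∈ M ∧ a = Real.exp (Real.log a) := by
    obtain ⟨m, hm, rfl⟩ := (Multiset.mem_filter.mp ha).2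
    simpa using hm
  have htwo (a : ℝ) (ha : a ∈ u.filter fun a => ¬ P a) : 2 ≤ a := by
    obtain ⟨hau, haP⟩ := Multiset.mem_filter.mp ha
    rcases eq_zero_or_exp_or_two_le_of_mem_closure_exp hpos (hu a hau).1 with h | h | h
    exacts [absurd h (hu0 a hau), absurd h haP, h]
  have hone (a : ℝ) (ha : a ∈ u.filter P) : 1 ≤ a := by
    rw [(hlog a ha).2]
    exact Real.one_le_exp (hpos _ (hlog a ha).1)
  have hprod : (u.filter P).prod * (u.filter fun a => ¬ P a).prod = q := by
    rw [← Multiset.prod_add, hsplit, huq]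
  have hexp : Real.exp ((u.filter P).map Real.log).sum = (u.filter P).prod := by
    rw [Real.exp_multiset_sum, Multiset.map_map]
    conv_rhs => rw [← Multiset.map_id (u.filter P)]
    exact congrArg _ (Multiset.map_congr rfl fun a ha => (hlog a ha).2.symm)
  rw [← hsplit, Multiset.card_add]
  refine add_le_add ?_ ?_
  · rw [← Multiset.card_map Real.log]
    refine hB _ (fun y hy => ?_) _ (multiset_prod_mem_closure_exp _ fun a ha =>
      (hu a (Multiset.mem_of_mem_filter ha)).1) (by rw [hexp, hprod])
    obtain ⟨a, ha, rfl⟩ := Multiset.mem_map.mp hy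
    refine ⟨(hlog a ha).1, fun h => (hu a (Multiset.mem_of_mem_filter ha)).2 ?_⟩
    rw [(hlog a ha).2, h, Real.exp_zero]
  · have h1 : 1 ≤ (u.filter P).prod := Multiset.one_le_prod hone
    have h2 : (2 : ℝ) ^ Multiset.card (u.filter fun a => ¬ P a) ≤
        (u.filter fun a => ¬ P a).prod := by
      simpa using Multiset.prod_map_le_prod_map₀ (s := u.filter fun a => ¬ P a)
        (fun _ => (2 : ℝ)) id (fun _ _ => zero_le_two) htwo
    have h3 : (2 : ℝ) ^ Multiset.card (u.filter fun a => ¬ P a) < 2 ^ L := by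
      refine lt_of_le_of_lt (h2.trans ?_) hL
      rw [← hprod]
      exact le_mul_of_one_le_left ((by positivity : (0 : ℝ) ≤ _).trans h2) h1
    exact ((pow_lt_pow_iff_right₀ one_lt_two).mp h3).le

theorem exists_mulFactorization_of_card_le {M : AddSubmonoid ℝ} {q : ℝ}
    (hq : q ∈ AddSubmonoid.closure (Real.exp '' (M : Set ℝ))) (hq0 : q ≠ 0) {B : ℕ}
    (hB : ∀ u : Multiset ℝ,
      (∀ a ∈ u, a ∈ AddSubmonoid.closure (Real.exp '' (M : Set ℝ)) ∧ a ≠ 1) →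
        u.prod = q → Multiset.card u ≤ B) :
    (MulFactorizations
      (AddSubmonoid.closure (Real.exp '' (M : Set ℝ)) : Set ℝ) q).Nonempty := by
  classical
  set S := AddSubmonoid.closure (Real.exp '' (M : Set ℝ))
  set lengths : Set ℕ :=
    {n | ∃ u : Multiset ℝ, (∀ a ∈ u, a ∈ S ∧ a ≠ 1) ∧ u.prod = q ∧ Multiset.card u = n}
  have hne : lengths.Nonempty := by
    by_cases hq1 : q = 1
    · exact ⟨0, 0, by simp, by simp [hq1], rfl⟩
    · exact ⟨1, {q}, by simpa using ⟨hq, hq1⟩, by simp, by simp⟩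
  have hbdd : BddAbove lengths := ⟨B, by rintro _ ⟨u, hu, huq, rfl⟩; exact hB u hu huq⟩
  obtain ⟨u, hu, huq, hcard⟩ := Nat.sSup_mem hne hbdd
  refine ⟨u, fun a ha => ⟨(hu a ha).1, ?_, (hu a ha).2, fun b hb c hc habc => ?_⟩, huq⟩
  · rintro rfl
    exact hq0 (huq ▸ Multiset.prod_eq_zero ha)
  · by_contra! h
    have hlen : Multiset.card (b ::ₘ c ::ₘ u.erase a) ∈ lengths := by
      refine ⟨_, fun x hx => ?_, ?_, rfl⟩
      · rcases Multiset.mem_cons.mp hx with rfl | hx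
        · exact ⟨hb, h.1⟩
        rcases Multiset.mem_cons.mp hx with rfl | hx
        · exact ⟨hc, h.2⟩
        exact hu x (Multiset.mem_of_mem_erase hx)
      · rw [Multiset.prod_cons, Multiset.prod_cons, ← mul_assoc, ← habc, Multiset.prod_erase ha,
          huq]
    have := le_csSup hbdd hlen
    have hpos := Multiset.card_erase_add_one ha
    simp only [Multiset.card_cons] at this
    omega

/-- If a positive monoid `M` of algebraic numbers is a BFM, then the exponentiation
semiring `E(M)` is a bounded factorization semiring: its multiplicative monoid of
nonzero elements is atomic, and each nonzero element has a finite set of lengths. -/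
theorem bfm_ascends_to_exponentiation_semiring
    (M : AddSubmonoid ℝ) (hpos : ∀ x ∈ M, (0 : ℝ) ≤ x)
    (halg : ∀ x ∈ M, IsAlgebraic ℚ x)
    (hBFM : IsBFM (M : Set ℝ)) :
    (∀ q ∈ AddSubmonoid.closure (Real.exp '' (M : Set ℝ)), q ≠ 0 →
      (MulFactorizations (AddSubmonoid.closure (Real.exp '' (M : Set ℝ)) : Set ℝ) q).Nonempty) ∧
    (∀ q ∈ AddSubmonoid.closure (Real.exp '' (M : Set ℝ)), q ≠ 0 →
      {ℓ : ℕ | ∃ s ∈ MulFactorizations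
          (AddSubmonoid.closure (Real.exp '' (M : Set ℝ)) : Set ℝ) q,
        Multiset.card s = ℓ}.Finite) := by
  refine ⟨fun q hq hq0 => ?_, fun q hq hq0 => ?_⟩
  all_goals obtain ⟨B, hB⟩ := exists_card_le_of_prod_eq hpos halg hBFM hq hq0
  · exact exists_mulFactorization_of_card_le hq hq0 hB
  · refine (Set.finite_Iic B).subset ?_
    rintro _ ⟨s, ⟨hs, hsq⟩, rfl⟩
    exact hB s (fun a ha => ⟨(hs a ha).1, (hs a ha).2.2.1⟩) hsq
end

section
/- Let (p_n)_{n≥1} be a strictly increasing sequence of prime numbers, set a_n := 1 + (-1)^n / p_n for each n ∈ ℕ, and let M be the positive monoid generated by {a_n : n ∈ ℕ}. Then M is atomic and the set of atoms of M is exactly {a_n : n ∈ ℕ}. -/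
theorem isAddAtomic_of_generators_atoms {S : Set ℝ}
    (hS : ∀ s ∈ S, IsAddAtom (AddSubmonoid.closure S : Set ℝ) s) :
    IsAddAtomic (AddSubmonoid.closure S : Set ℝ) := by
  intro x hx _
  obtain ⟨m, hm, rfl⟩ := AddSubmonoid.exists_multiset_of_mem_closure hx
  exact ⟨m, fun s hs => hS s (hm s hs), rfl⟩

theorem IsAddAtom.mem_of_closure {S : Set ℝ} {x : ℝ}
    (hx : IsAddAtom (AddSubmonoid.closure S : Set ℝ) x) : x ∈ S := by
  obtain ⟨m, hm, hsum⟩ := AddSubmonoid.exists_multiset_of_mem_closure hx.1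
  induction m using Multiset.induction with
  | empty => exact absurd hsum.symm hx.2.1
  | cons s m ih =>
    rw [Multiset.sum_cons] at hsum
    have hs : s ∈ S := hm s (Multiset.mem_cons_self s m)
    have hm' : ∀ y ∈ m, y ∈ S := fun y hy => hm y (Multiset.mem_cons_of_mem hy)
    have hmem : m.sum ∈ AddSubmonoid.closure S :=
      AddSubmonoid.multiset_sum_mem _ _ fun y hy => AddSubmonoid.subset_closure (hm' y hy)
    rcases hx.2.2 s (AddSubmonoid.subset_closure hs) m.sum hmem hsum.symm with h | h
    · exact ih hm' (by rw [← hsum, h, zero_add])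
    · rw [← hsum, h, add_zero]
      exact hs

theorem nonneg_of_mem_closure {S : Set ℝ} (hS : ∀ s ∈ S, 0 < s) {x : ℝ}
    (hx : x ∈ AddSubmonoid.closure S) : 0 ≤ x :=
  (AddSubmonoid.closure_le (S := AddSubmonoid.nonneg ℝ)).2 (fun s hs => (hS s hs).le) hx

/-- The real numbers that can be written as a fraction whose denominator is coprime to `q`. -/
def HasCoprimeDenom (q : ℕ) (x : ℝ) : Prop :=
  ∃ (d : ℕ) (z : ℤ), d.Coprime q ∧ (d : ℝ) * x = z

theorem HasCoprimeDenom.add {q : ℕ} {x y : ℝ} (hx : HasCoprimeDenom q x)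
    (hy : HasCoprimeDenom q y) : HasCoprimeDenom q (x + y) := by
  obtain ⟨d, z, hd, hz⟩ := hx
  obtain ⟨e, w, he, hw⟩ := hy
  refine ⟨d * e, e * z + d * w, hd.mul_left he, ?_⟩
  push_cast
  rw [← hz, ← hw]
  ring

theorem hasCoprimeDenom_zero (q : ℕ) : HasCoprimeDenom q 0 :=
  ⟨1, 0, Nat.coprime_one_left q, by simp⟩

theorem hasCoprimeDenom_one_add_div {q r : ℕ} (hr : r ≠ 0) (h : r.Coprime q) (n : ℕ) :
    HasCoprimeDenom q (1 + (-1) ^ n / (r : ℝ)) := by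
  refine ⟨r, r + (-1) ^ n, h, ?_⟩
  have : (r : ℝ) ≠ 0 := Nat.cast_ne_zero.2 hr
  push_cast
  field_simp

theorem not_hasCoprimeDenom_one_add_div {q : ℕ} (hq : q.Prime) (n : ℕ) :
    ¬ HasCoprimeDenom q (1 + (-1) ^ n / (q : ℝ)) := by
  rintro ⟨d, z, hd, hz⟩
  have hq0 : (q : ℝ) ≠ 0 := Nat.cast_ne_zero.2 hq.ne_zero
  field_simp at hz
  have hz' : (d : ℤ) * (q + (-1) ^ n) = q * z := by exact_mod_cast hz
  have hdvd : (q : ℤ) ∣ d * (-1) ^ n := ⟨z - d, by linear_combination hz'⟩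
  have hqd : (q : ℤ) ∣ d := by
    rcases neg_one_pow_eq_or ℤ n with h | h <;> simpa [h] using hdvd
  exact hq.one_lt.ne' (Nat.eq_one_of_dvd_coprimes hd (Int.natCast_dvd_natCast.1 hqd) dvd_rfl)

/-- A positive generator is an atom of the closure if, unlike all other generators, it has no
fraction representation with denominator coprime to `q`. -/
theorem isAddAtom_of_not_hasCoprimeDenom {S : Set ℝ} (hS : ∀ s ∈ S, 0 < s) {q : ℕ} {t : ℝ}
    (ht : t ∈ S) (hqt : ¬ HasCoprimeDenom q t)
    (hq : ∀ s ∈ S, s ≠ t → HasCoprimeDenom q s) :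
    IsAddAtom (AddSubmonoid.closure S : Set ℝ) t := by
  have key : ∀ x ∈ AddSubmonoid.closure S, t ≤ x ∨ HasCoprimeDenom q x := by
    intro x hx
    induction hx using AddSubmonoid.closure_induction with
    | mem s hs =>
      by_cases h : s = t
      · exact .inl h.ge
      · exact .inr (hq s hs h)
    | zero => exact .inr (hasCoprimeDenom_zero q)
    | add x y hx hy ihx ihy =>
      have hx0 := nonneg_of_mem_closure hS hx
      have hy0 := nonneg_of_mem_closure hS hy
      rcases ihx with hx' | hx'
      · exact .inl (by linarith)
      rcases ihy with hy' | hy'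
      · exact .inl (by linarith)
      exact .inr (hx'.add hy')
  refine ⟨AddSubmonoid.subset_closure ht, (hS t ht).ne', fun b hb c hc hbc => ?_⟩
  have hb0 := nonneg_of_mem_closure hS hb
  have hc0 := nonneg_of_mem_closure hS hc
  rcases key b hb with hb' | hb'
  · exact .inr (by linarith)
  rcases key c hc with hc' | hc'
  · exact .inl (by linarith)
  exact absurd (hbc ▸ hb'.add hc') hqt

theorem one_add_neg_one_pow_div_pos {q : ℕ} (hq : 1 < q) (n : ℕ) :
    0 < 1 + (-1) ^ n / (q : ℝ) := by
  have hq' : (1 : ℝ) < q := Nat.one_lt_cast.2 hq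
  have hq0 : (0 : ℝ) < q := by linarith
  rw [one_add_div hq0.ne']
  refine div_pos ?_ hq0
  rcases neg_one_pow_eq_or ℝ n with h | h <;> rw [h] <;> linarith

/-- For a strictly increasing sequence of primes `(p_n)_{n ≥ 1}` and
`a_n := 1 + (-1)^n / p_n`, the positive monoid generated by `{a_n : n ≥ 1}` is
atomic and its set of atoms is exactly `{a_n : n ≥ 1}`. -/
theorem atoms_of_alternating_prime_monoid
    (p : ℕ → ℕ) (hp : ∀ n ∈ Set.Ici 1, (p n).Prime)
    (hmono : StrictMonoOn p (Set.Ici 1))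
    (a : ℕ → ℝ) (ha : ∀ n, a n = 1 + (-1) ^ n / (p n : ℝ))
    (M : AddSubmonoid ℝ) (hgen : M = AddSubmonoid.closure (a '' Set.Ici 1)) :
    IsAddAtomic (M : Set ℝ) ∧ {x : ℝ | IsAddAtom (M : Set ℝ) x} = a '' Set.Ici 1 := by
  subst hgen
  have hpos : ∀ s ∈ a '' Set.Ici 1, 0 < s := by
    rintro _ ⟨n, hn, rfl⟩
    rw [ha]
    exact one_add_neg_one_pow_div_pos (hp n hn).one_lt n
  have hatom : ∀ s ∈ a '' Set.Ici 1,
      IsAddAtom (AddSubmonoid.closure (a '' Set.Ici 1) : Set ℝ) s := by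
    rintro _ ⟨n, hn, rfl⟩
    refine isAddAtom_of_not_hasCoprimeDenom (q := p n) hpos ⟨n, hn, rfl⟩ ?_ ?_
    · rw [ha]
      exact not_hasCoprimeDenom_one_add_div (hp n hn) n
    · rintro _ ⟨m, hm, rfl⟩ hne
      rw [ha]
      refine hasCoprimeDenom_one_add_div (hp m hm).ne_zero ?_ m
      refine (Nat.coprime_primes (hp m hm) (hp n hn)).2 fun h => hne ?_
      rw [hmono.injOn hm hn h]
  exact ⟨isAddAtomic_of_generators_atoms hatom,
    Set.Subset.antisymm (fun _ hx => IsAddAtom.mem_of_closure hx) hatom⟩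
end
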